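/- Main theorem, strict version: Let K be a field, S_1, …, S_n sets of localities on K, t ∈ K^×, x_1, …, x_n ∈ K and z_1, …, z_n ∈ K^×. Assume: (U) Assumption (U) holds for S = S_1 ∪ ⋯ ∪ S_n and t; (T) each S_i is compact in the topology T_{Zar*}; (I) for any valuation ring O_w of K having a refinement in S_i and a refinement in S_j we have x_i − x_j ∈ z_i·O_w and z_i·O_w = z_j·O_w, and moreover the sets S_1, …, S_n are pairwise t-independent and pairwise incomparable. Then there exists x ∈ K with x − x_i ∈ z_i·m_v for all v ∈ S_i, for i = 1, …, n. -/

import Mathlib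

namespace PaperApprox

variable {K : Type*} [Field K]

/-- The "maximal ideal" `m_O = O \ O^×` of a ball `O`, where `O^× = O ∩ O⁻¹` and
`O⁻¹ = {x⁻¹ : 0 ≠ x ∈ O} = {x | x ≠ 0 ∧ x⁻¹ ∈ O}`. -/
def mball (O : Set K) : Set K := O \ (O ∩ {x | x ≠ 0 ∧ x⁻¹ ∈ O})

/-- The scaled set `z·S`. -/
def scale (z : K) (S : Set K) : Set K := {y | ∃ s ∈ S, y = z * s}

/-- A positive cone of a field ordering. -/
def IsOrderingCone (P : Set K) : Prop :=
  (∀ a ∈ P, ∀ b ∈ P, a + b ∈ P) ∧ (∀ a ∈ P, ∀ b ∈ P, a * b ∈ P) ∧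
    (∀ x : K, x ∈ P ∨ -x ∈ P) ∧ ∀ x : K, x ∈ P → -x ∈ P → x = 0

/-- `x ≤_P y` for a positive cone `P`. -/
def coneLE (P : Set K) (a b : K) : Prop := b - a ∈ P

/-- `x <_P y` for a positive cone `P`. -/
def coneLT (P : Set K) (a b : K) : Prop := b - a ∈ P ∧ a ≠ b

/-- The unit interval `{x : -1 ≤_P x ≤_P 1}` of an ordering. -/
def orderingBall (P : Set K) : Set K := {x | x + 1 ∈ P ∧ 1 - x ∈ P}

/-- `O` is the valuation ring of a (Krull) valuation on `K`. -/
def IsValuationLocality (O : Set K) : Prop := ∃ A : ValuationSubring K, O = (A : Set K)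

/-- `O` is the unit interval of a field ordering of `K`. -/
def IsOrderingLocality (O : Set K) : Prop := ∃ P : Set K, IsOrderingCone P ∧ O = orderingBall P

/-- `O` is the closed unit ball of an absolute value on `K`. -/
def IsAbsLocality (O : Set K) : Prop := ∃ f : AbsoluteValue K ℝ, O = {x | f x ≤ 1}

/-- A locality on `K`, identified with its ring/ball `O`. -/
def IsLocality (O : Set K) : Prop := IsValuationLocality O ∨ IsOrderingLocality O ∨ IsAbsLocality O

/-- `W` is the finest common coarsening of the localities `O₁`, `O₂`. -/
def IsFCC (O₁ O₂ W : Set K) : Prop :=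
  IsLocality W ∧ O₁ ⊆ W ∧ O₂ ⊆ W ∧ ∀ W', IsLocality W' → O₁ ⊆ W' → O₂ ⊆ W' → W ⊆ W'

/-- Two subsets `A`, `B` of `W` have the same image in the residue field `W/m_W`. -/
def SameResidue (W A B : Set K) : Prop :=
  (∀ x ∈ A, ∃ y ∈ B, x - y ∈ mball W) ∧ ∀ y ∈ B, ∃ x ∈ A, x - y ∈ mball W

/-- Incomparability of localities. -/
def Incomp (O₁ O₂ : Set K) : Prop := ¬O₁ ⊆ O₂ ∧ ¬O₂ ⊆ O₁

/-- Strong incomparability: incomparable, and the induced localities on the residue field of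
the finest common coarsening are distinct (their rings, i.e. the images of `O₁` and `O₂`,
differ). -/
def StronglyIncomp (O₁ O₂ : Set K) : Prop :=
  Incomp O₁ O₂ ∧ ∀ W, IsFCC O₁ O₂ W → ¬SameResidue W O₁ O₂

/-- `t`-independence of localities. -/
def TIndep (t : K) (O₁ O₂ : Set K) : Prop :=
  (∀ W, IsFCC O₁ O₂ W → t ∈ W ∧ t⁻¹ ∈ W) ∧
    (IsOrderingLocality O₁ → IsOrderingLocality O₂ → StronglyIncomp O₁ O₂)

/-- `t`-independence of valuation rings: `t` and `t⁻¹` lie in the smallest valuation ring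
containing both. -/
def TIndepVal (t : K) (O₁ O₂ : Set K) : Prop :=
  ∀ W : Set K, IsValuationLocality W → O₁ ⊆ W → O₂ ⊆ W →
    (∀ W', IsValuationLocality W' → O₁ ⊆ W' → O₂ ⊆ W' → W ⊆ W') → t ∈ W ∧ t⁻¹ ∈ W

/-- `t`-independence of sets of localities. -/
def SetTIndep (t : K) (S₁ S₂ : Set (Set K)) : Prop := ∀ v ∈ S₁, ∀ w ∈ S₂, TIndep t v w

/-- Incomparability of sets of localities. -/
def SetIncomp (S₁ S₂ : Set (Set K)) : Prop := ∀ v ∈ S₁, ∀ w ∈ S₂, Incomp v w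

/-- Independence of localities: the field topologies they induce on `K` (with the sets
`z·m_v`, `z ∈ K^×`, as neighbourhood bases of `0`) are distinct. -/
def IndepLoc (O₁ O₂ : Set K) : Prop :=
  ¬((∀ z : K, z ≠ 0 → ∃ z' : K, z' ≠ 0 ∧ scale z' (mball O₂) ⊆ scale z (mball O₁)) ∧
     ∀ z : K, z ≠ 0 → ∃ z' : K, z' ≠ 0 ∧ scale z' (mball O₁) ⊆ scale z (mball O₂))

/-- The Zariski topology on localities/balls of `K`. -/
def zarTop (K : Type*) [Field K] : TopologicalSpace (Set K) :=
  TopologicalSpace.generateFrom {U | ∃ x : K, U = {O : Set K | x ∈ O}}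

/-- The Hochster dual of the Zariski topology. -/
def zarStarTop (K : Type*) [Field K] : TopologicalSpace (Set K) :=
  TopologicalSpace.generateFrom {U | ∃ x : K, U = {O : Set K | x ∈ mball O}}

/-- The constructible topology. -/
def conTop (K : Type*) [Field K] : TopologicalSpace (Set K) :=
  TopologicalSpace.generateFrom
    ({U | ∃ x : K, U = {O : Set K | x ∈ O}} ∪ {U | ∃ x : K, U = {O : Set K | x ∈ mball O}})

/-- The Harrison topology on orderings (positive cones) of `K`. -/
def harrisonTop (K : Type*) [Field K] : TopologicalSpace (Set K) :=
  TopologicalSpace.generateFrom {U | ∃ x : K, x ≠ 0 ∧ U = {P : Set K | x ∈ P}}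

/-- Condition (i): `f(O) ⊆ O`. -/
def CondI (f : Polynomial K) (O : Set K) : Prop := ∀ x ∈ O, f.eval x ∈ O

/-- Condition (ii): `f(x) ∉ t·m_O` for `x ∈ O`. -/
def CondII (t : K) (f : Polynomial K) (O : Set K) : Prop := ∀ x ∈ O, f.eval x ∉ scale t (mball O)

/-- Condition (iii): `f(x) ∈ x^d (O \ t·m_O) ∩ (a_d x^d + x^(d-1) O)` for `x ∉ O`. -/
def CondIII (t : K) (f : Polynomial K) (O : Set K) : Prop :=
  ∀ x : K, x ∉ O →
    f.eval x ∈ scale (x ^ f.natDegree) (O \ scale t (mball O)) ∧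
      ∃ u ∈ O, f.eval x = f.leadingCoeff * x ^ f.natDegree + x ^ (f.natDegree - 1) * u

/-- Condition (iv): `O + O ⊆ t⁻¹·O`. -/
def CondIV (t : K) (O : Set K) : Prop := ∀ a ∈ O, ∀ b ∈ O, a + b ∈ scale t⁻¹ O

/-- Assumption (U) for a set `S` of localities and `t ∈ K^×`. -/
def AssumptionU (S : Set (Set K)) (t : K) : Prop :=
  ∃ f : Polynomial K, 2 ≤ f.natDegree ∧
    ∀ v ∈ S, CondI f v ∧ CondII t f v ∧ CondIII t f v ∧ CondIV t v

/-- Assumption (U-exc) for finitely many sets `S 1, …, S n` of localities and `t ∈ K^×`: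
conditions (i), (iii), (iv) everywhere, and condition (ii) on the infinite `S i`. -/
def AssumptionUExc {n : ℕ} (S : Fin n → Set (Set K)) (t : K) : Prop :=
  ∃ f : Polynomial K, 2 ≤ f.natDegree ∧
    (∀ i, ∀ v ∈ S i, CondI f v ∧ CondIII t f v ∧ CondIV t v) ∧
      ∀ i, (S i).Infinite → ∀ v ∈ S i, CondII t f v

/-- `S_π^e(K)`: valuation rings whose value group has a smallest positive element `γ`
(multiplicatively: a largest element `γ < 1`), such that `ℤγ` is convex and
`0 < v(π) ≤ eγ` (multiplicatively `γ^e ≤ v(π) < 1`). -/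
def SPiE (π : K) (e : ℕ) : Set (Set K) :=
  {O | ∃ A : ValuationSubring K, O = (A : Set K) ∧
    ∃ γ : A.ValueGroup, γ ≠ 0 ∧ γ < 1 ∧
      (∀ δ : A.ValueGroup, δ ≠ 0 → δ < 1 → δ ≤ γ) ∧
      (∀ δ : A.ValueGroup, δ ≠ 0 → ∀ m n : ℤ, γ ^ m ≤ δ → δ ≤ γ ^ n → ∃ k : ℤ, δ = γ ^ k) ∧
      A.valuation π < 1 ∧ γ ^ e ≤ A.valuation π}

/-- `O_w` is convex with respect to the ordering with positive cone `P`. -/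
def ConvexWrtOrdering (P W : Set K) : Prop :=
  ∀ u w : K, u ∈ P → w - u ∈ P → w ∈ W → u ∈ W

/-- Iterated application `φ(x₁, φ(x₂, …))`. -/
def iterPhi (φ : K → K → K) : K → List K → K
  | x, [] => x
  | x, y :: l => φ x (iterPhi φ y l)

/-! ### Abstract properties of localities -/

/-- The multiplicative properties shared by all localities. -/
structure LocP (O : Set K) : Prop where
  zero : (0 : K) ∈ O
  one : (1 : K) ∈ O
  mul : ∀ a ∈ O, ∀ b ∈ O, a * b ∈ O
  neg : ∀ a ∈ O, -a ∈ O
  total : ∀ a : K, a ∈ O ∨ a⁻¹ ∈ O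

lemma mem_scale {z : K} (hz : z ≠ 0) {S : Set K} {y : K} : y ∈ scale z S ↔ z⁻¹ * y ∈ S := by
  constructor
  · rintro ⟨s, hs, rfl⟩
    rwa [inv_mul_cancel_left₀ hz]
  · intro h
    exact ⟨_, h, by rw [mul_inv_cancel_left₀ hz]⟩

lemma mem_mball {O : Set K} {a : K} : a ∈ mball O ↔ a ∈ O ∧ (a ≠ 0 → a⁻¹ ∉ O) := by
  unfold mball
  simp only [Set.mem_sdiff, Set.mem_inter_iff, Set.mem_ofPred_eq]
  tauto

lemma LocP.pow {O : Set K} (h : LocP O) {a : K} (ha : a ∈ O) (k : ℕ) : a ^ k ∈ O := by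
  induction k with
  | zero => simpa using h.one
  | succ k ih => rw [pow_succ]; exact h.mul _ ih _ ha

lemma LocP.mball_mul {O : Set K} (h : LocP O) {a b : K} (ha : a ∈ mball O) (hb : b ∈ O) :
    a * b ∈ mball O := by
  rw [mem_mball] at *
  refine ⟨h.mul _ ha.1 _ hb, fun h0 h1 => ?_⟩
  have ha0 : a ≠ 0 := left_ne_zero_of_mul h0
  have hb0 : b ≠ 0 := right_ne_zero_of_mul h0
  apply ha.2 ha0
  have : a⁻¹ = b * (a * b)⁻¹ := by field_simp
  rw [this]
  exact h.mul _ hb _ h1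

lemma LocP.zero_mball {O : Set K} (h : LocP O) : (0 : K) ∈ mball O := by
  rw [mem_mball]; exact ⟨h.zero, fun h => absurd rfl h⟩

lemma mball_sub {O : Set K} {a : K} (ha : a ∈ mball O) : a ∈ O := ha.1

lemma LocP.inv_mball {O : Set K} (h : LocP O) {a : K} (ha : a ∉ O) : a⁻¹ ∈ mball O := by
  rw [mem_mball]
  exact ⟨(h.total a).resolve_left ha, fun _ => by rwa [inv_inv]⟩

lemma LocP.div_mball {O : Set K} (h : LocP O) {a b : K} (ha : a ∈ O) (hb : b ∉ O) :
    a / b ∈ mball O := by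
  rw [div_eq_inv_mul]
  exact h.mball_mul (h.inv_mball hb) ha

lemma LocP.mball_add {O : Set K} (h : LocP O) {t : K} (ht : t ≠ 0) (h4 : CondIV t O) {a b : K}
    (ha : a ∈ mball O) (hb : b ∈ mball O) : t * (a + b) ∈ mball O := by
  have key : ∀ a b : K, a ∈ mball O → b ∈ mball O → a / b ∈ O → t * (a + b) ∈ mball O := by
    intro a b ha hb hab
    by_cases hb0 : b = 0
    · subst hb0
      have := h4 1 h.one 0 h.zero
      rw [mem_scale (inv_ne_zero ht)] at this
      rw [add_zero, mul_comm]
      exact h.mball_mul ha (by simpa using this)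
    · have := h4 _ hab 1 h.one
      rw [mem_scale (inv_ne_zero ht), inv_inv] at this
      have e : t * (a + b) = b * (t * (a / b + 1)) := by field_simp
      rw [e]
      exact h.mball_mul hb this
  rcases h.total (a / b) with h1 | h1
  · exact key a b ha hb h1
  · rw [inv_div] at h1
    rw [add_comm]
    exact key b a hb ha h1

lemma LocP.not_tm {O : Set K} (h : LocP O) {t : K} (ht : t ≠ 0) {g : K}
    (hg : g ∉ scale t (mball O)) : g ≠ 0 ∧ t * g⁻¹ ∈ O := by
  rw [mem_scale ht] at hg
  refine ⟨fun h0 => hg (by rw [h0, mul_zero]; exact h.zero_mball), ?_⟩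
  by_contra hc
  apply hg
  have := h.inv_mball hc
  rwa [mul_inv, inv_inv] at this

/-! ### Orderings -/

lemma ordering_rep.{u} {K : Type u} [Field K] {O : Set K} (h : IsOrderingLocality O) :
    ∃ (F : Type u) (_ : Field F) (_ : LinearOrder F) (_ : IsStrictOrderedRing F) (φ : K →+* F),
      O = {x | |φ x| ≤ 1} := by
  classical
  obtain ⟨P, ⟨hadd, hmul, htot, hanti⟩, rfl⟩ := h
  have h0 : (0 : K) ∈ P := by rcases htot 0 with h | h <;> simpa using h
  have h1 : (1 : K) ∈ P := by
    rcases htot 1 with h | h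
    · exact h
    · simpa using hmul _ h _ h
  letI : LinearOrder K :=
    { le := fun a b => b - a ∈ P
      le_refl := fun a => by simpa using h0
      le_trans := fun a b c hab hbc => by simpa using hadd _ hab _ hbc
      le_antisymm := fun a b hab hba => by
        have := hanti _ hab (by simpa using hba)
        exact (sub_eq_zero.mp this).symm
      le_total := fun a b => by simpa using htot (b - a)
      toDecidableLE := Classical.decRel _ }
  have hle : ∀ a b : K, a ≤ b ↔ b - a ∈ P := fun a b => Iff.rfl
  have : IsOrderedAddMonoid K :=
    { add_le_add_left := fun a b hab c => by rw [hle] at *; simpa using hab }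
  have : ZeroLEOneClass K := ⟨by rw [hle]; simpa using h1⟩
  have : IsStrictOrderedRing K := IsStrictOrderedRing.of_mul_pos (fun a b ha hb => by
    refine lt_of_le_of_ne ?_ (mul_ne_zero ha.ne' hb.ne').symm
    rw [hle, sub_zero]
    exact hmul _ (by simpa [hle] using ha.le) _ (by simpa [hle] using hb.le))
  refine ⟨K, inferInstance, inferInstance, inferInstance, RingHom.id K, ?_⟩
  ext x
  simp only [orderingBall, Set.mem_ofPred_eq, RingHom.id_apply, abs_le]
  rw [hle, hle, sub_neg_eq_add]

lemma IsLocality.locP {O : Set K} (h : IsLocality O) : LocP O := by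
  rcases h with ⟨A, rfl⟩ | h | ⟨f, rfl⟩
  · exact ⟨A.zero_mem, A.one_mem, fun a ha b hb => A.mul_mem _ _ ha hb, fun a ha => A.neg_mem _ ha,
      fun a => A.mem_or_inv_mem a⟩
  · obtain ⟨F, _, _, _, φ, rfl⟩ := ordering_rep h
    refine ⟨by simp, by simp, fun a ha b hb => ?_, fun a ha => by simpa using ha, fun a => ?_⟩
    · simp only [Set.mem_ofPred_eq, map_mul, abs_mul] at *
      exact mul_le_one₀ ha (abs_nonneg _) hb
    · simp only [Set.mem_ofPred_eq, map_inv₀, abs_inv]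
      rcases le_total |φ a| 1 with h | h
      · exact Or.inl h
      · exact Or.inr (inv_le_one_of_one_le₀ h)
  · refine ⟨by simp, by simp, fun a ha b hb => ?_, fun a ha => by simpa using ha, fun a => ?_⟩
    · simp only [Set.mem_ofPred_eq, map_mul] at *
      exact mul_le_one₀ ha (f.nonneg _) hb
    · simp only [Set.mem_ofPred_eq, map_inv₀]
      rcases le_total (f a) 1 with h | h
      · exact Or.inl h
      · exact Or.inr (inv_le_one_of_one_le₀ h)

/-! ### The product of two balls -/

/-- The product set of two balls. -/
def prodBall (O₁ O₂ : Set K) : Set K := {x | ∃ r ∈ O₁, ∃ s ∈ O₂, x = r * s}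

lemma exists_sep {v w : Set K} (hv : LocP v) (hw : LocP w) (hi : Incomp v w) :
    ∃ a : K, a ≠ 0 ∧ a ∈ mball v ∧ a⁻¹ ∈ mball w := by
  obtain ⟨h1, h2⟩ := hi
  rw [Set.not_subset] at h1 h2
  obtain ⟨p, hp, hp'⟩ := h1
  obtain ⟨q, hq, hq'⟩ := h2
  refine ⟨p / q, ?_, hv.div_mball hp hq', ?_⟩
  · apply div_ne_zero
    · rintro rfl; exact hp' hw.zero
    · rintro rfl; exact hq' hv.zero
  · rw [inv_div]; exact hw.div_mball hq hp'

lemma prodBall_val {v w : Set K} (hv : LocP v) (hw : LocP w) {a b : K}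
    (ha : a ∈ prodBall v w) (hb : b ∈ prodBall v w)
    (hav : ∀ γ ∈ v, ∃ δ ∈ v, 1 + γ = a * δ) (hbw : ∀ γ ∈ w, ∃ δ ∈ w, 1 + γ = b * δ) :
    IsValuationLocality (prodBall v w) := by
  have hvM : ∀ x ∈ v, x ∈ prodBall v w := fun x hx => ⟨x, hx, 1, hw.one, by simp⟩
  have hwM : ∀ x ∈ w, x ∈ prodBall v w := fun x hx => ⟨1, hv.one, x, hx, by simp⟩
  have hmul : ∀ x ∈ prodBall v w, ∀ y ∈ prodBall v w, x * y ∈ prodBall v w := by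
    rintro _ ⟨r, hr, s, hs, rfl⟩ _ ⟨r', hr', s', hs', rfl⟩
    exact ⟨r * r', hv.mul _ hr _ hr', s * s', hw.mul _ hs _ hs', by ring⟩
  have h1v : ∀ γ ∈ v, 1 + γ ∈ prodBall v w := by
    intro γ hγ
    obtain ⟨δ, hδ, e⟩ := hav γ hγ
    rw [e]; exact hmul _ ha _ (hvM _ hδ)
  have h1w : ∀ γ ∈ w, 1 + γ ∈ prodBall v w := by
    intro γ hγ
    obtain ⟨δ, hδ, e⟩ := hbw γ hγ
    rw [e]; exact hmul _ hb _ (hwM _ hδ)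
  have h1 : ∀ γ ∈ prodBall v w, 1 + γ ∈ prodBall v w := by
    intro γ hγ
    rcases hv.total γ with h | h
    · exact h1v _ h
    · by_cases h0 : γ = 0
      · subst h0; exact h1v _ hv.zero
      · have : 1 + γ = γ * (1 + γ⁻¹) := by field_simp; ring
        rw [this]
        exact hmul _ hγ _ (h1v _ h)
  have htot : ∀ x, x ∈ prodBall v w ∨ x⁻¹ ∈ prodBall v w := fun x =>
    (hv.total x).imp (hvM _) (hvM _)
  have hadd : ∀ x ∈ prodBall v w, ∀ y ∈ prodBall v w, x + y ∈ prodBall v w := by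
    intro x hx y hy
    by_cases hx0 : x = 0
    · simpa [hx0] using hy
    by_cases hy0 : y = 0
    · simpa [hy0] using hx
    rcases htot (y / x) with h | h
    · have : x + y = x * (1 + y / x) := by field_simp
      rw [this]; exact hmul _ hx _ (h1 _ h)
    · rw [inv_div] at h
      have : x + y = y * (1 + x / y) := by field_simp; ring
      rw [this]; exact hmul _ hy _ (h1 _ h)
  refine ⟨{ carrier := prodBall v w
            mul_mem' := fun {x y} hx hy => hmul x hx y hy
            one_mem' := hvM _ hv.one
            add_mem' := fun {x y} hx hy => hadd x hx y hy
            zero_mem' := hvM _ hv.zero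
            neg_mem' := ?_
            mem_or_inv_mem' := htot }, rfl⟩
  rintro _ ⟨r, hr, s, hs, rfl⟩
  exact ⟨-r, hv.neg _ hr, s, hs, by ring⟩

/-- Two non-separated orderings: elements at most `1/2` at the first have size `< 1` at the
second. -/
lemma ord_symm {F F' : Type*} [Field F] [LinearOrder F] [IsStrictOrderedRing F]
    [Field F'] [LinearOrder F'] [IsStrictOrderedRing F'] (φ : K →+* F) (ψ : K →+* F')
    (H : ∀ a, |φ a| ≤ 1 / 2 → |ψ a| < 1) : ∀ a, |ψ a| ≤ 1 / 2 → |φ a| < 1 := by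
  intro a ha
  by_contra hc
  push Not at hc
  have ha0 : a ≠ 0 := by
    rintro rfl; simp at hc; linarith [zero_lt_one (α := F)]
  have h2 := H (a⁻¹ / 2) ?_
  · have hp : 0 < |ψ a| := by simpa using ha0
    simp only [map_div₀, map_inv₀, abs_div, abs_inv, map_ofNat, Nat.abs_ofNat] at h2
    have : |ψ a|⁻¹ < 2 := by linarith
    rw [inv_lt_comm₀ hp (by norm_num)] at this
    norm_num at this ha
    linarith
  · simp only [map_div₀, map_inv₀, abs_div, abs_inv, map_ofNat, Nat.abs_ofNat]
    have := inv_le_one_of_one_le₀ hc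
    linarith

lemma ord_bound {F F' : Type*} [Field F] [LinearOrder F] [IsStrictOrderedRing F]
    [Field F'] [LinearOrder F'] [IsStrictOrderedRing F'] (φ : K →+* F) (ψ : K →+* F')
    (H : ∀ a, |φ a| ≤ 1 / 2 → |ψ a| < 1) (a : K) (h : ∃ n : ℕ, |φ a| ≤ n) :
    ∃ n : ℕ, |ψ a| ≤ n := by
  obtain ⟨n, hn⟩ := h
  have := H (a / (2 * (n + 1))) ?_
  · refine ⟨2 * (n + 1), ?_⟩
    have hp : (0 : F') < 2 * (n + 1) := by positivity
    simp only [map_div₀, map_mul, map_add, map_natCast, map_ofNat, map_one, abs_div] at this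
    rw [abs_of_pos hp, div_lt_one hp] at this
    push_cast
    exact this.le
  · have hp : (0 : F) < 2 * (n + 1) := by positivity
    simp only [map_div₀, map_mul, map_add, map_natCast, map_ofNat, map_one, abs_div]
    rw [abs_of_pos hp, div_le_div_iff₀ hp (by norm_num)]
    linarith

/-- The convex hull of the integers. -/
def hull {F : Type*} [Field F] [LinearOrder F] [IsStrictOrderedRing F] (φ : K →+* F) :
    ValuationSubring K where
  carrier := {x | ∃ n : ℕ, |φ x| ≤ n}
  mul_mem' := by
    rintro a b ⟨n, hn⟩ ⟨m, hm⟩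
    refine ⟨n * m, ?_⟩
    rw [map_mul, abs_mul]; push_cast
    exact mul_le_mul hn hm (abs_nonneg _) (by positivity)
  one_mem' := ⟨1, by simp⟩
  add_mem' := by
    rintro a b ⟨n, hn⟩ ⟨m, hm⟩
    refine ⟨n + m, ?_⟩
    rw [map_add]; push_cast
    exact (abs_add_le _ _).trans (add_le_add hn hm)
  zero_mem' := ⟨0, by simp⟩
  neg_mem' := by
    rintro a ⟨n, hn⟩
    exact ⟨n, by simpa using hn⟩
  mem_or_inv_mem' := by
    intro a
    simp only [Set.mem_ofPred_eq, map_inv₀, abs_inv]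
    rcases le_total |φ a| 1 with h | h
    · exact Or.inl ⟨1, by simpa using h⟩
    · exact Or.inr ⟨1, by simpa using inv_le_one_of_one_le₀ h⟩

lemma mem_hull {F : Type*} [Field F] [LinearOrder F] [IsStrictOrderedRing F] (φ : K →+* F)
    (x : K) : x ∈ (hull φ : Set K) ↔ ∃ n : ℕ, |φ x| ≤ n := Iff.rfl

lemma hull_residue_pos {F F' : Type*} [Field F] [LinearOrder F] [IsStrictOrderedRing F]
    [Field F'] [LinearOrder F'] [IsStrictOrderedRing F'] (φ : K →+* F) (ψ : K →+* F')
    (H : ∀ a, |φ a| ≤ 1 / 2 → |ψ a| < 1) (x : K) (hx : |φ x| ≤ 1) (hx' : 1 < ψ x) :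
    x - 1 ∈ mball (hull φ : Set K) := by
  have hxV : x - 1 ∈ (hull φ : Set K) :=
    (hull φ).sub_mem ((mem_hull φ x).2 ⟨1, by simpa using hx⟩) (hull φ).one_mem
  rw [mem_mball]
  refine ⟨hxV, fun h0 hinv => ?_⟩
  set ε := x - 1 with hε
  have hψ : 0 < ψ ε := by simp [hε, hx']
  have hφ : φ ε ≤ 0 := by simp only [hε, map_sub, map_one]; linarith [(abs_le.1 hx).2]
  obtain ⟨n, hn⟩ := ord_bound φ ψ H ε⁻¹ hinv
  obtain ⟨k, hk⟩ := hxV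
  have hn1 : 1 ≤ n * ψ ε := by
    rw [map_inv₀, abs_inv, abs_of_pos hψ] at hn
    rwa [inv_le_iff_one_le_mul₀ hψ] at hn
  -- the integral part of `-4 n ε` at `φ`
  have hex : ∃ m : ℕ, -(4 * n * φ ε) < m + 1 := by
    refine ⟨4 * n * k, ?_⟩
    rw [abs_of_nonpos hφ] at hk
    push_cast
    have : (4 * n : F) * (-φ ε) ≤ 4 * n * k := mul_le_mul_of_nonneg_left hk (by positivity)
    linarith
  classical
  let m := Nat.find hex
  have hm : -(4 * n * φ ε) < m + 1 := Nat.find_spec hex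
  have hm' : (m : F) ≤ -(4 * n * φ ε) := by
    by_cases h : m = 0
    · rw [h, Nat.cast_zero]
      have : (0 : F) ≤ (4 * n : F) * (-φ ε) := mul_nonneg (by positivity) (by linarith)
      linarith
    · obtain ⟨j, hj⟩ := Nat.exists_eq_succ_of_ne_zero h
      have := Nat.find_min hex (m := j) (show j < m by omega)
      rw [hj]; push_cast
      linarith
  have := H ((4 * n * ε + m) / 4) ?_
  · simp only [map_div₀, map_add, map_mul, map_natCast, map_ofNat] at this
    have hm0 : (0 : F') ≤ m := by positivity
    have := (abs_lt.1 this).2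
    linarith
  · simp only [map_div₀, map_add, map_mul, map_natCast, map_ofNat]
    rw [abs_le]
    constructor <;> linarith

lemma mball_neg {O : Set K} (h : LocP O) {a : K} (ha : a ∈ mball O) : -a ∈ mball O := by
  have := h.mball_mul ha (h.neg _ h.one)
  simpa using this

lemma hull_residue {F F' : Type*} [Field F] [LinearOrder F] [IsStrictOrderedRing F]
    [Field F'] [LinearOrder F'] [IsStrictOrderedRing F'] (φ : K →+* F) (ψ : K →+* F')
    (H : ∀ a, |φ a| ≤ 1 / 2 → |ψ a| < 1) (x : K) (hx : |φ x| ≤ 1) :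
    ∃ y, |ψ y| ≤ 1 ∧ x - y ∈ mball (hull φ : Set K) := by
  have hL : LocP (hull φ : Set K) := IsLocality.locP (Or.inl ⟨_, rfl⟩)
  by_cases h : |ψ x| ≤ 1
  · exact ⟨x, h, by simpa using hL.zero_mball⟩
  · rw [not_le, lt_abs] at h
    rcases h with h | h
    · exact ⟨1, by simp, hull_residue_pos φ ψ H x hx h⟩
    · refine ⟨-1, by simp, ?_⟩
      have := mball_neg hL (hull_residue_pos φ ψ H (-x) (by simpa using hx) (by simpa using h))
      have e : x - -1 = -(-x - 1) := by ring
      rwa [e]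

lemma abs_nat_le_one (f : AbsoluteValue K ℝ) (c : K) (hc : c ≠ 0) (h : ∀ k : ℕ, f (k * c) ≤ 1)
    (n : ℕ) : f n ≤ 1 := by
  by_contra hn
  push Not at hn
  have hp : 0 < f c := f.pos hc
  obtain ⟨j, hj⟩ := pow_unbounded_of_one_lt (f c)⁻¹ hn
  have := h (n ^ j)
  rw [map_mul] at this
  push_cast at this
  rw [map_pow] at this
  rw [inv_lt_iff_one_lt_mul₀ hp] at hj
  linarith

lemma ord_two_mem {F F' : Type*} [Field F] [LinearOrder F] [IsStrictOrderedRing F]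
    [Field F'] [LinearOrder F'] [IsStrictOrderedRing F'] (φ : K →+* F) (ψ : K →+* F')
    (hs : StronglyIncomp {x | |φ x| ≤ 1} {x | |ψ x| ≤ 1})
    (hv : IsLocality {x | |φ x| ≤ 1}) (hw : IsLocality {x | |ψ x| ≤ 1}) :
    (2 : K) ∈ prodBall {x | |φ x| ≤ 1} {x | |ψ x| ≤ 1} := by
  by_contra h2
  have H : ∀ a, |φ a| ≤ 1 / 2 → |ψ a| < 1 := by
    intro a ha
    by_contra hc
    push Not at hc
    have ha0 : a ≠ 0 := by
      rintro rfl; simp at hc; linarith [zero_lt_one (α := F')]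
    refine h2 ⟨2 * a, ?_, a⁻¹, ?_, by field_simp⟩
    · simp only [Set.mem_ofPred_eq, map_mul, map_ofNat, abs_mul, Nat.abs_ofNat]
      linarith
    · simp only [Set.mem_ofPred_eq, map_inv₀, abs_inv]
      exact inv_le_one_of_one_le₀ hc
  have H' := ord_symm φ ψ H
  have hVV : (hull φ : Set K) = hull ψ := by
    ext x
    exact ⟨ord_bound φ ψ H x, ord_bound ψ φ H' x⟩
  obtain ⟨hi, hs⟩ := hs
  obtain ⟨a, ha0, ha, ha'⟩ := exists_sep hv.locP hw.locP hi
  have haφ : |φ a| < 1 := by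
    rw [mem_mball] at ha
    have := ha.2 ha0
    simp only [Set.mem_ofPred_eq, map_inv₀, abs_inv] at this
    by_contra hc
    exact this (inv_le_one_of_one_le₀ (not_lt.1 hc))
  have hav : a ∈ {x | |φ x| ≤ 1} := mball_sub ha
  have haw : a⁻¹ ∈ {x | |ψ x| ≤ 1} := mball_sub ha'
  refine hs (hull φ) ⟨Or.inl ⟨_, rfl⟩, ?_, ?_, ?_⟩ ⟨?_, ?_⟩
  · intro x hx; exact ⟨1, by simpa using hx⟩
  · rw [hVV]; intro x hx; exact ⟨1, by simpa using hx⟩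
  · rintro W' hW' hvW hwW x ⟨n, hn⟩
    have hn0 : ((n + 1 : ℕ) : F) ≠ 0 := by positivity
    have hn0K : ((n + 1 : ℕ) : K) ≠ 0 := by
      intro h; apply hn0; rw [← map_natCast φ, h, map_zero]
    have hx1 : x / (n + 1 : ℕ) ∈ W' := by
      apply hvW
      have hp : (0 : F) < (n + 1 : ℕ) := by positivity
      simp only [Set.mem_ofPred_eq, map_div₀, map_natCast, abs_div]
      rw [abs_of_pos hp, div_le_one hp]
      push_cast; linarith
    have hxe : x = x / (n + 1 : ℕ) * (n + 1 : ℕ) := by field_simp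
    rw [hxe]
    refine hW'.locP.mul _ hx1 _ ?_
    rcases hW' with ⟨A, rfl⟩ | hW' | ⟨f, rfl⟩
    · exact natCast_mem A _
    · exfalso
      obtain ⟨F'', _, _, _, χ, rfl⟩ := ordering_rep hW'
      have h1 : |χ a| ≤ 1 := hvW hav
      have h3 : |χ a⁻¹| ≤ 1 := hwW haw
      have hp : 0 < |χ a| := by simpa using ha0
      rw [map_inv₀, abs_inv, inv_le_one₀ hp] at h3
      have h4 : |χ a| = 1 := le_antisymm h1 h3
      have h5 : a ^ 2 = 1 := by
        apply χ.injective
        rw [map_pow, map_one, ← sq_abs, h4, one_pow]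
      have h6 : |φ a| ^ 2 = 1 := by rw [sq_abs, ← map_pow, h5, map_one]
      nlinarith [abs_nonneg (φ a)]
    · refine abs_nat_le_one f (1 - a ^ 2) ?_ ?_ _
      · intro h
        have h5 : a ^ 2 = 1 := (sub_eq_zero.1 h).symm
        have h6 : |φ a| ^ 2 = 1 := by rw [sq_abs, ← map_pow, h5, map_one]
        nlinarith [abs_nonneg (φ a)]
      · intro k
        apply hvW
        have hA : (0 : F) ≤ φ a ^ 2 := sq_nonneg _
        have hA1 : φ a ^ 2 < 1 := by rw [← sq_abs]; nlinarith [abs_nonneg (φ a)]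
        set A := φ a ^ 2 with hAdef
        have hhalf : 1 / 2 < A ^ k := by
          by_contra hc
          push Not at hc
          have := H ((a ^ 2) ^ k) (by rw [map_pow, map_pow, abs_of_nonneg (by positivity)]; exact hc)
          have hge : 1 ≤ |ψ a| := by
            have hp : 0 < |ψ a| := by simpa using ha0
            have h3 := haw
            simp only [Set.mem_ofPred_eq, map_inv₀, abs_inv] at h3
            rwa [inv_le_one₀ hp] at h3
          have h7 : 1 ≤ |ψ ((a ^ 2) ^ k)| := by
            rw [map_pow, map_pow, abs_pow, abs_pow]
            exact one_le_pow₀ (one_le_pow₀ hge)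
          linarith
        have hb : 1 + k * (1 - A) ≤ (1 + (1 - A)) ^ k :=
          one_add_mul_le_pow (by linarith) k
        have hc : A ^ k * (1 + (1 - A)) ^ k ≤ 1 := by
          rw [← mul_pow]
          exact pow_le_one₀ (mul_nonneg hA (by linarith)) (by nlinarith)
        have hd : 0 ≤ k * (1 - A) := mul_nonneg (by positivity) (by linarith)
        simp only [Set.mem_ofPred_eq, map_mul, map_natCast, map_sub, map_one, map_pow]
        rw [← hAdef, abs_of_nonneg hd]
        have he : A ^ k * (1 + k * (1 - A)) ≤ 1 :=
          (mul_le_mul_of_nonneg_left hb (by linarith)).trans hc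
        nlinarith
  · intro x hx
    exact hull_residue φ ψ H x hx
  · intro y hy
    obtain ⟨x, hx, hxy⟩ := hull_residue ψ φ H' y hy
    refine ⟨x, hx, ?_⟩
    rw [hVV]
    have hL : LocP (hull ψ : Set K) := IsLocality.locP (Or.inl ⟨_, rfl⟩)
    simpa using mball_neg hL hxy

lemma abs_prodBall {v w : Set K} (hv : LocP v) (hw : LocP w) (hi : Incomp v w)
    (h : IsAbsLocality v) : ∀ x, x ∈ prodBall v w := by
  intro x
  obtain ⟨a, ha0, ha, ha'⟩ := exists_sep hv hw hi
  obtain ⟨f, rfl⟩ := h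
  have hfa : f a < 1 := by
    rw [mem_mball] at ha
    have := ha.2 ha0
    simp only [Set.mem_ofPred_eq, map_inv₀] at this
    by_contra hc
    exact this (inv_le_one_of_one_le₀ (not_lt.1 hc))
  by_cases hx0 : x = 0
  · exact ⟨0, hv.zero, 1, hw.one, by simp [hx0]⟩
  have hp : 0 < f x := f.pos hx0
  obtain ⟨k, hk⟩ := exists_pow_lt_of_lt_one (inv_pos.2 hp) hfa
  refine ⟨x * a ^ k, ?_, a⁻¹ ^ k, hw.pow (mball_sub ha') k, ?_⟩
  swap
  · rw [inv_pow, mul_assoc, mul_inv_cancel₀ (pow_ne_zero _ ha0), mul_one]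
  simp only [Set.mem_ofPred_eq, map_mul, map_pow]
  rw [lt_inv_comm₀ (pow_pos (f.pos ha0) k) hp] at hk
  calc f x * f a ^ k ≤ (f a ^ k)⁻¹ * f a ^ k :=
        mul_le_mul_of_nonneg_right hk.le (by positivity)
    _ = 1 := inv_mul_cancel₀ (pow_pos (f.pos ha0) k).ne'

lemma Incomp.swap {v w : Set K} (h : Incomp v w) : Incomp w v := ⟨h.2, h.1⟩

lemma prodBall_comm {v w : Set K} : prodBall v w = prodBall w v := by
  ext x
  constructor <;> rintro ⟨r, hr, s, hs, rfl⟩ <;> exact ⟨s, hs, r, hr, mul_comm _ _⟩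

lemma ord_one_add {v : Set K} (h : IsOrderingLocality v) (γ : K) (hγ : γ ∈ v) :
    ∃ δ ∈ v, 1 + γ = 2 * δ := by
  obtain ⟨F, _, _, _, φ, rfl⟩ := ordering_rep h
  have h2 : (2 : K) ≠ 0 := by
    intro h; have := congrArg φ h; rw [map_ofNat, map_zero] at this; exact two_ne_zero this
  refine ⟨(1 + γ) / 2, ?_, by field_simp⟩
  simp only [Set.mem_ofPred_eq, map_div₀, map_add, map_one, map_ofNat] at *
  rw [abs_le] at *
  constructor <;> linarith

lemma prodBall_isVal {t : K} {v w : Set K} (hv : IsLocality v) (hw : IsLocality w)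
    (hi : Incomp v w) (hti : TIndep t v w) :
    IsValuationLocality (prodBall v w) := by
  have full : (∀ x, x ∈ prodBall v w) → IsValuationLocality (prodBall v w) := fun h =>
    ⟨⊤, by ext x; simp [h x]⟩
  have hvM : ∀ x ∈ v, x ∈ prodBall v w := fun x hx => ⟨x, hx, 1, hw.locP.one, by simp⟩
  have hwM : ∀ x ∈ w, x ∈ prodBall v w := fun x hx => ⟨1, hv.locP.one, x, hx, by simp⟩
  have val1 : ∀ u : Set K, IsValuationLocality u → ∀ γ ∈ u, ∃ δ ∈ u, 1 + γ = 1 * δ := by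
    rintro _ ⟨A, rfl⟩ γ hγ
    exact ⟨1 + γ, A.add_mem _ _ A.one_mem hγ, by simp⟩
  have val2 : ∀ u : Set K, IsValuationLocality u → (2 : K) ∈ u := by
    rintro _ ⟨A, rfl⟩
    exact ofNat_mem A 2
  have hvP := hv.locP
  have hwP := hw.locP
  by_cases hva : IsAbsLocality v
  · exact full (abs_prodBall hvP hwP hi hva)
  by_cases hwa : IsAbsLocality w
  · apply full
    rw [prodBall_comm]
    exact abs_prodBall hwP hvP hi.swap hwa
  have hv' := hv
  have hw' := hw
  rcases hv' with h | h | h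
  · rcases hw' with h' | h' | h'
    · exact prodBall_val hvP hwP (hvM _ hvP.one) (hvM _ hvP.one) (val1 v h) (val1 w h')
    · exact prodBall_val hvP hwP (hvM _ hvP.one) (hvM _ (val2 v h)) (val1 v h) (ord_one_add h')
    · exact absurd h' hwa
  · rcases hw' with h' | h' | h'
    · exact prodBall_val hvP hwP (hwM _ (val2 w h')) (hwM _ hwP.one) (ord_one_add h) (val1 w h')
    · have h2 : (2 : K) ∈ prodBall v w := by
        have hs := hti.2 h h'
        obtain ⟨F, _, _, _, φ, rfl⟩ := ordering_rep h
        obtain ⟨F', _, _, _, ψ, rfl⟩ := ordering_rep h'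
        exact ord_two_mem φ ψ hs hv hw
      exact prodBall_val hvP hwP h2 h2 (ord_one_add h) (ord_one_add h')
    · exact absurd h' hwa
  · exact absurd h hva

lemma prodBall_fcc {t : K} {v w : Set K} (hv : IsLocality v) (hw : IsLocality w)
    (hi : Incomp v w) (hti : TIndep t v w) :
    IsFCC v w (prodBall v w) := by
  refine ⟨Or.inl (prodBall_isVal hv hw hi hti), fun x hx => ⟨x, hx, 1, hw.locP.one, by simp⟩,
    fun x hx => ⟨1, hv.locP.one, x, hx, by simp⟩, ?_⟩
  rintro W' hW' h1 h2 _ ⟨r, hr, s, hs, rfl⟩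
  exact hW'.locP.mul _ (h1 hr) _ (h2 hs)

/-! ### Consequences of Assumption (U) -/

/-- A locality together with the conditions in Assumption (U). -/
structure Good (t : K) (f : Polynomial K) (O : Set K) : Prop where
  loc : LocP O
  h1 : CondI f O
  h2 : CondII t f O
  h3 : CondIII t f O
  h4 : CondIV t O

lemma Good.f_spec {t : K} (ht : t ≠ 0) {f : Polynomial K} {O : Set K} (h : Good t f O) (x : K) :
    ∃ g ∈ O, g ≠ 0 ∧ t * g⁻¹ ∈ O ∧
      ((x ∈ O ∧ f.eval x = g) ∨ (x ∉ O ∧ f.eval x = x ^ f.natDegree * g)) := by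
  by_cases hx : x ∈ O
  · obtain ⟨a, b⟩ := h.loc.not_tm ht (h.h2 x hx)
    exact ⟨_, h.h1 x hx, a, b, Or.inl ⟨hx, rfl⟩⟩
  · obtain ⟨⟨g, ⟨hg, hg'⟩, e⟩, -⟩ := h.h3 x hx
    obtain ⟨a, b⟩ := h.loc.not_tm ht hg'
    exact ⟨g, hg, a, b, Or.inr ⟨hx, e⟩⟩

lemma Good.t_mem {t : K} (ht : t ≠ 0) {f : Polynomial K} {O : Set K} (h : Good t f O) : t ∈ O := by
  have := h.h4 1 h.loc.one 0 h.loc.zero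
  rw [mem_scale (inv_ne_zero ht)] at this
  simpa using this

/-- `y` is large at `O`, of size more than `(tc)⁻¹`. -/
def Big (t c : K) (O : Set K) (y : K) : Prop := y ≠ 0 ∧ y⁻¹ ∈ scale (t * c) (mball O)

lemma scale_mul {O : Set K} (h : LocP O) {c y b : K} (hy : y ∈ scale c (mball O)) (hb : b ∈ O) :
    y * b ∈ scale c (mball O) := by
  obtain ⟨s, hs, rfl⟩ := hy
  exact ⟨s * b, h.mball_mul hs hb, by ring⟩

lemma scale_le {O : Set K} (h : LocP O) {c b y : K} (hy : y ∈ scale (c * b) (mball O))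
    (hb : b ∈ O) : y ∈ scale c (mball O) := by
  obtain ⟨s, hs, rfl⟩ := hy
  exact ⟨s * b, h.mball_mul hs hb, by ring⟩

/-- The combining lemma. -/
lemma combine {t : K} (ht : t ≠ 0) {f : Polynomial K} (hf : 2 ≤ f.natDegree) (y₁ y₂ : K) :
    ∃ y : K,
      (∀ O, Good t f O → ∀ c ∈ O, y₁ ∈ scale c (mball O) → y₂ ∈ scale c (mball O) →
        y ∈ scale c (mball O)) ∧
      (∀ O, Good t f O → ∀ c ∈ O, Big t c O y₁ ∨ Big t c O y₂ → Big t c O y) := by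
  by_cases h0 : y₂ = 0
  · refine ⟨y₁, fun _ _ _ _ h _ => h, fun O _ c _ h => h.resolve_right fun h => h.1 h0⟩
  obtain ⟨d, hd⟩ : ∃ d, f.natDegree = d + 2 := ⟨f.natDegree - 2, by omega⟩
  -- it suffices to look at the larger of `y₁`, `y₂`
  have key : ∀ O, Good t f O → ∃ g ∈ O, g ≠ 0 ∧ t * g⁻¹ ∈ O ∧ ∃ m, m ≠ 0 ∧ (m = y₁ ∨ m = y₂) ∧
      y₁ / m ∈ O ∧ y₂ / m ∈ O ∧ y₂ ^ (d + 2) * f.eval (y₁ / y₂) = m ^ (d + 2) * g := by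
    intro O hO
    obtain ⟨g, hg, hg0, hg', h | h⟩ := hO.f_spec ht (y₁ / y₂)
    · exact ⟨g, hg, hg0, hg', y₂, h0, Or.inr rfl, h.1, by rw [div_self h0]; exact hO.loc.one,
        by rw [h.2]⟩
    · have h10 : y₁ ≠ 0 := by
        rintro rfl
        apply h.1
        rw [zero_div]; exact hO.loc.zero
      refine ⟨g, hg, hg0, hg', y₁, h10, Or.inl rfl, by rw [div_self h10]; exact hO.loc.one, ?_, ?_⟩
      · rw [← inv_div]; exact (hO.loc.total _).resolve_left h.1
      · rw [h.2, hd, div_pow]; field_simp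
  refine ⟨y₂ ^ (d + 2) * f.eval (y₁ / y₂), fun O hO c hc hs₁ hs₂ => ?_, fun O hO c hc hb => ?_⟩
  · obtain ⟨g, hg, -, -, m, -, hm, -, -, e⟩ := key O hO
    have hs : m ∈ scale c (mball O) := by rcases hm with rfl | rfl <;> assumption
    have hmO : m ∈ O := by
      obtain ⟨s, hs, rfl⟩ := hs
      exact hO.loc.mul _ hc _ (mball_sub hs)
    rw [e, show m ^ (d + 2) * g = m * (m ^ (d + 1) * g) by ring]
    exact scale_mul hO.loc hs (hO.loc.mul _ (hO.loc.pow hmO _) _ hg)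
  · obtain ⟨g, hg, hg0, hg', m, hm0, -, h1, h2, e⟩ := key O hO
    have hM : m⁻¹ ∈ scale (t * c) (mball O) := by
      rcases hb with hb | hb
      · have : m⁻¹ = y₁⁻¹ * (y₁ / m) := by have := hb.1; field_simp
        rw [this]; exact scale_mul hO.loc hb.2 h1
      · have : m⁻¹ = y₂⁻¹ * (y₂ / m) := by field_simp
        rw [this]; exact scale_mul hO.loc hb.2 h2
    refine ⟨by rw [e]; exact mul_ne_zero (pow_ne_zero _ hm0) hg0, ?_⟩
    obtain ⟨μ, hμ, eμ⟩ := hM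
    have hmi : m⁻¹ ∈ O := by
      rw [eμ]; exact hO.loc.mul _ (hO.loc.mul _ (hO.t_mem ht) _ hc) _ (mball_sub hμ)
    have e2 : (m ^ (d + 2) * g)⁻¹ = m⁻¹ * (m⁻¹ ^ d * (c * μ * (t * g⁻¹))) := by
      have : c * μ * (t * g⁻¹) = m⁻¹ * g⁻¹ := by rw [eμ]; ring
      rw [this, mul_inv, ← inv_pow]; ring
    rw [e, e2]
    exact scale_mul hO.loc ⟨μ, hμ, eμ⟩ (hO.loc.mul _ (hO.loc.pow hmi _) _
      (hO.loc.mul _ (hO.loc.mul _ hc _ (mball_sub hμ)) _ hg'))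

lemma isOpen_scale (c y : K) (hc : c ≠ 0) :
    @IsOpen (Set K) (zarStarTop K) {O | y ∈ scale c (mball O)} := by
  have : {O : Set K | y ∈ scale c (mball O)} = {O | c⁻¹ * y ∈ mball O} := by
    ext O; exact mem_scale hc
  rw [this]
  exact TopologicalSpace.GenerateOpen.basic _ ⟨_, rfl⟩

/-- Compactness: local large elements glue. -/
lemma glue {t : K} (ht : t ≠ 0) {f : Polynomial K} (hf : 2 ≤ f.natDegree) (Q : Set (Set K × K))
    (hQ : ∀ q ∈ Q, Good t f q.1 ∧ q.2 ∈ q.1) (T : Set (Set K)) (hT : ∀ v ∈ T, Good t f v)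
    (hc : @IsCompact (Set K) (zarStarTop K) T) (c : K) (hc0 : c ≠ 0) (hcT : ∀ v ∈ T, c ∈ v)
    (h : ∀ v ∈ T, ∃ y, (∀ q ∈ Q, y ∈ scale q.2 (mball q.1)) ∧ Big t c v y) :
    ∃ y, (∀ q ∈ Q, y ∈ scale q.2 (mball q.1)) ∧ ∀ v ∈ T, Big t c v y := by
  have := @IsCompact.induction_on (Set K) (zarStarTop K) T hc
    (fun U => ∃ y, (∀ q ∈ Q, y ∈ scale q.2 (mball q.1)) ∧ ∀ v ∈ T, v ∈ U → Big t c v y)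
    ?_ ?_ ?_ ?_
  · obtain ⟨y, h1, h2⟩ := this
    exact ⟨y, h1, fun v hv => h2 v hv hv⟩
  · exact ⟨0, fun q hq => ⟨0, (hQ q hq).1.loc.zero_mball, by simp⟩, fun v _ hv => hv.elim⟩
  · rintro U U' hUU ⟨y, h1, h2⟩
    exact ⟨y, h1, fun v hv hvU => h2 v hv (hUU hvU)⟩
  · rintro U U' ⟨y₁, h1, h2⟩ ⟨y₂, h3, h4⟩
    obtain ⟨y, hy1, hy2⟩ := combine ht hf y₁ y₂
    refine ⟨y, fun q hq => hy1 _ (hQ q hq).1 _ (hQ q hq).2 (h1 q hq) (h3 q hq), ?_⟩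
    intro v hv hvU
    exact hy2 v (hT v hv) c (hcT v hv) (hvU.imp (h2 v hv) (h4 v hv))
  · intro v hv
    obtain ⟨y, h1, h2, h3⟩ := h v hv
    refine ⟨{O | y⁻¹ ∈ scale (t * c) (mball O)}, ?_, y, h1, fun w _ hw => ⟨h2, hw⟩⟩
    letI := zarStarTop K
    exact mem_nhdsWithin_of_mem_nhds ((isOpen_scale _ _ (mul_ne_zero ht hc0)).mem_nhds h3)

/-- Pointwise separation. -/
lemma sep_point {v w : Set K} (hv : LocP v) (hw : LocP w) (hi : Incomp v w) {b c : K} (hb : b ≠ 0)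
    (hc : c ≠ 0) (h : (b * c)⁻¹ ∈ prodBall v w) :
    ∃ y, y ≠ 0 ∧ y⁻¹ ∈ scale b (mball v) ∧ y ∈ scale c (mball w) := by
  obtain ⟨a, ha0, ha, ha'⟩ := exists_sep hv hw hi
  obtain ⟨r, hr, s, hs, e⟩ := h
  have h0 : r * s ≠ 0 := by rw [← e]; exact inv_ne_zero (mul_ne_zero hb hc)
  have hr0 := left_ne_zero_of_mul h0
  have hs0 := right_ne_zero_of_mul h0
  refine ⟨c * (a⁻¹ * s), mul_ne_zero hc (mul_ne_zero (inv_ne_zero ha0) hs0),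
    ⟨a * r, hv.mball_mul ha hr, ?_⟩, ⟨_, hw.mball_mul ha' hs, rfl⟩⟩
  have e1 : b * c * (r * s) = 1 := by rw [← e]; exact mul_inv_cancel₀ (mul_ne_zero hb hc)
  apply inv_eq_of_mul_eq_one_right
  calc c * (a⁻¹ * s) * (b * (a * r)) = (b * c * (r * s)) * (a⁻¹ * a) := by ring
    _ = 1 := by rw [e1, inv_mul_cancel₀ ha0, mul_one]

lemma Good.eval_coarse {t : K} {f : Polynomial K} {v W : Set K} (ht : t ≠ 0) (h : Good t f v)
    (hW : LocP W) (hvW : v ⊆ W) {x : K} (hx : x ∈ W) : f.eval x ∈ W := by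
  obtain ⟨g, hg, -, -, h | h⟩ := h.f_spec ht x
  · rw [h.2]; exact hvW hg
  · rw [h.2]; exact hW.mul _ (hW.pow hx _) _ (hvW hg)

/-- Shrinking the scaling factor into the balls. -/
lemma shrink {t : K} (ht : t ≠ 0) {f : Polynomial K} (hf : 2 ≤ f.natDegree)
    (T : Set (Set K)) (hT : ∀ v ∈ T, Good t f v) (B : K) (hB : B ≠ 0) :
    ∃ c : K, c ≠ 0 ∧ (∀ v ∈ T, c ∈ v ∧ B⁻¹ * c ∈ v) ∧
      ∀ W, LocP W → (∃ v ∈ T, v ⊆ W) → t⁻¹ ∈ W → B⁻¹ ∈ W → c⁻¹ ∈ W := by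
  rcases T.eq_empty_or_nonempty with rfl | ⟨v₀, hv₀⟩
  · exact ⟨1, one_ne_zero, by simp, by simp⟩
  refine ⟨t * (f.eval B⁻¹)⁻¹, ?_, ?_, ?_⟩
  · apply mul_ne_zero ht (inv_ne_zero _)
    obtain ⟨g, hg, hg0, -, h | h⟩ := (hT v₀ hv₀).f_spec ht B⁻¹
    · rw [h.2]; exact hg0
    · rw [h.2]; exact mul_ne_zero (pow_ne_zero _ (inv_ne_zero hB)) hg0
  · intro v hv
    have hG := hT v hv
    obtain ⟨g, hg, hg0, hg', h | h⟩ := hG.f_spec ht B⁻¹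
    · rw [h.2]; exact ⟨hg', hG.loc.mul _ h.1 _ hg'⟩
    · have hBO : B ∈ v := by have := (hG.loc.total _).resolve_left h.1; rwa [inv_inv] at this
      obtain ⟨d, hd⟩ : ∃ d, f.natDegree = d + 1 := ⟨f.natDegree - 1, by omega⟩
      have e : t * (f.eval B⁻¹)⁻¹ = B ^ (d + 1) * (t * g⁻¹) := by
        rw [h.2, hd, mul_inv, inv_pow, inv_inv]; ring
      rw [e]
      refine ⟨hG.loc.mul _ (hG.loc.pow hBO _) _ hg', ?_⟩
      have e' : B⁻¹ * (B ^ (d + 1) * (t * g⁻¹)) = B ^ d * (t * g⁻¹) := by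
        rw [pow_succ]; field_simp
      rw [e']
      exact hG.loc.mul _ (hG.loc.pow hBO _) _ hg'
  · rintro W hW ⟨v, hv, hvW⟩ htW hBW
    rw [mul_inv, inv_inv]
    exact hW.mul _ htW _ ((hT v hv).eval_coarse ht hW hvW hBW)

/-- The separation statement. -/
lemma separate {n : ℕ} {S : Fin n → Set (Set K)} {t : K} (ht : t ≠ 0) {f : Polynomial K}
    (hf : 2 ≤ f.natDegree) (hloc : ∀ i, ∀ v ∈ S i, IsLocality v)
    (hG : ∀ i, ∀ v ∈ S i, Good t f v)
    (hT : ∀ i, @IsCompact (Set K) (zarStarTop K) (S i))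
    (hti : ∀ i j, i ≠ j → SetTIndep t (S i) (S j))
    (hinc : ∀ i j, i ≠ j → SetIncomp (S i) (S j))
    (s : Finset (Fin n)) (k : Fin n) (hk : k ∉ s) (hne : ∃ i ∈ s, (S i).Nonempty)
    (B : Fin n → K) (hB : ∀ i, B i ≠ 0)
    (hBW : ∀ i ∈ s, ∀ v ∈ S i, ∀ w ∈ S k, ∀ W, IsValuationLocality W → v ⊆ W → w ⊆ W →
      (B i)⁻¹ ∈ W ∧ (B k)⁻¹ ∈ W) :
    ∃ a, (∀ i ∈ s, ∀ v ∈ S i, a ∈ mball v ∧ a ∈ scale (B i) (mball v)) ∧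
      ∀ w ∈ S k, a ≠ 0 ∧ a⁻¹ ∈ mball w ∧ a⁻¹ ∈ scale (B k) (mball w) := by
  choose c hc0 hc hcW using fun i => shrink ht hf (S i) (hG i) (B i) (hB i)
  have hlift : ∀ i, ∀ v ∈ S i, ∀ y, y ∈ scale (t * c i) (mball v) → y ∈ scale (B i) (mball v) := by
    intro i v hv y hy
    have hg := hG i v hv
    have e : t * c i = B i * ((B i)⁻¹ * c i) * t := by
      rw [mul_inv_cancel_left₀ (hB i)]; ring
    rw [e] at hy
    exact scale_le hg.loc (scale_le hg.loc hy (hg.t_mem ht)) (hc i v hv).2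
  have htc : ∀ i, ∀ v ∈ S i, t * c i ∈ v := fun i v hv =>
    (hG i v hv).loc.mul _ ((hG i v hv).t_mem ht) _ (hc i v hv).1
  have hsm : ∀ i, ∀ v ∈ S i, ∀ y, y ∈ scale (t * c i) (mball v) → y ∈ mball v := by
    rintro i v hv _ ⟨m, hm, rfl⟩
    rw [mul_comm]
    exact (hG i v hv).loc.mball_mul hm (htc i v hv)
  -- pointwise
  have hpt : ∀ i ∈ s, ∀ v ∈ S i, ∀ w ∈ S k,
      ∃ y, y ∈ scale (t * c k) (mball w) ∧ Big t (c i) v y := by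
    intro i hi v hv w hw
    have hik : i ≠ k := fun h => hk (h ▸ hi)
    have hI := hinc i k hik v hv w hw
    have hT := hti i k hik v hv w hw
    have hvl := hloc i v hv
    have hwl := hloc k w hw
    have hval := prodBall_isVal hvl hwl hI hT
    have hfcc := prodBall_fcc hvl hwl hI hT
    have hP : LocP (prodBall v w) := IsLocality.locP (Or.inl hval)
    have htW := (hT.1 _ hfcc).2
    obtain ⟨h1, h2⟩ := hBW i hi v hv w hw _ hval hfcc.2.1 hfcc.2.2.1
    have h3 := hcW i _ hP ⟨v, hv, hfcc.2.1⟩ htW h1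
    have h4 := hcW k _ hP ⟨w, hw, hfcc.2.2.1⟩ htW h2
    obtain ⟨y, hy0, hy1, hy2⟩ := sep_point hvl.locP hwl.locP hI (b := t * c i) (c := t * c k)
      (mul_ne_zero ht (hc0 i)) (mul_ne_zero ht (hc0 k)) (by
        rw [mul_inv, mul_inv, mul_inv]
        exact hP.mul _ (hP.mul _ htW _ h3) _ (hP.mul _ htW _ h4))
    exact ⟨y, hy2, hy0, hy1⟩
  -- first gluing
  have hst1 : ∀ w ∈ S k, ∃ y, y ∈ scale (t * c k) (mball w) ∧
      ∀ i ∈ s, ∀ v ∈ S i, Big t (c i) v y := by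
    intro w hw
    have hg := hG k w hw
    suffices H : ∀ s' : Finset (Fin n), s' ⊆ s → ∃ y, y ∈ scale (t * c k) (mball w) ∧
        ∀ i ∈ s', ∀ v ∈ S i, Big t (c i) v y from H s (Finset.Subset.refl s)
    intro s'
    induction s' using Finset.induction_on with
    | empty => exact fun _ => ⟨0, ⟨0, hg.loc.zero_mball, by simp⟩, by simp⟩
    | insert j s' hj ih =>
      intro hs
      obtain ⟨y₁, h1, h2⟩ := ih (fun x hx => hs (Finset.mem_insert_of_mem hx))
      have hjs : j ∈ s := hs (Finset.mem_insert_self _ _)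
      obtain ⟨y₂, h3, h4⟩ := glue ht hf {(w, t * c k)} (by
          rintro _ rfl; exact ⟨hg, htc k w hw⟩) (S j) (hG j) (hT j) (c j) (hc0 j)
        (fun v hv => (hc j v hv).1) (by
          intro v hv
          obtain ⟨y, hy1, hy2⟩ := hpt j hjs v hv w hw
          exact ⟨y, by rintro _ rfl; exact hy1, hy2⟩)
      obtain ⟨y, hy1, hy2⟩ := combine ht hf y₁ y₂
      refine ⟨y, hy1 w hg _ (htc k w hw) h1 (h3 _ rfl), ?_⟩
      intro i hi v hv
      apply hy2 v (hG i v hv) _ (hc i v hv).1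
      rcases Finset.mem_insert.1 hi with rfl | hi
      · exact Or.inr (h4 v hv)
      · exact Or.inl (h2 i hi v hv)
  -- second gluing
  obtain ⟨i₀, hi₀, v₀, hv₀⟩ := hne
  obtain ⟨a, ha1, ha2⟩ := glue ht hf {q | ∃ i ∈ s, ∃ v ∈ S i, q = (v, t * c i)} (by
      rintro _ ⟨i, hi, v, hv, rfl⟩
      exact ⟨hG i v hv, htc i v hv⟩) (S k) (hG k) (hT k) (c k) (hc0 k)
    (fun w hw => (hc k w hw).1) (by
      intro w hw
      obtain ⟨y, hy1, hy2⟩ := hst1 w hw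
      refine ⟨y⁻¹, ?_, inv_ne_zero (hy2 i₀ hi₀ v₀ hv₀).1, by rwa [inv_inv]⟩
      rintro _ ⟨i, hi, v, hv, rfl⟩
      exact (hy2 i hi v hv).2)
  refine ⟨a, fun i hi v hv => ⟨hsm i v hv _ (ha1 _ ⟨i, hi, v, hv, rfl⟩),
    hlift i v hv _ (ha1 _ ⟨i, hi, v, hv, rfl⟩)⟩, fun w hw => ?_⟩
  exact ⟨(ha2 w hw).1, hsm k w hw _ (ha2 w hw).2, hlift k w hw _ (ha2 w hw).2⟩

lemma Good.lead_mem {t : K} (ht : t ≠ 0) {f : Polynomial K} {O : Set K} (h : Good t f O)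
    (hf : 2 ≤ f.natDegree) {x : K} (hx : x ∉ O) : t * f.leadingCoeff ∈ O := by
  obtain ⟨⟨g, ⟨hg, -⟩, e⟩, u, hu, e'⟩ := h.h3 x hx
  have hx0 : x ≠ 0 := by rintro rfl; exact hx h.loc.zero
  obtain ⟨d, hd⟩ : ∃ d, f.natDegree = d + 1 := ⟨f.natDegree - 1, by omega⟩
  have hxi : x⁻¹ ∈ O := (h.loc.total x).resolve_left hx
  have h4 := h.h4 g hg _ (h.loc.neg _ (h.loc.mul _ hxi _ hu))
  rw [mem_scale (inv_ne_zero ht), inv_inv] at h4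
  have e2 : f.leadingCoeff = g + -(x⁻¹ * u) := by
    rw [e, hd, Nat.add_sub_cancel] at e'
    have hp : x ^ (d + 1) ≠ 0 := pow_ne_zero _ hx0
    apply mul_left_cancel₀ hp
    have : x ^ (d + 1) * (g + -(x⁻¹ * u)) = x ^ (d + 1) * g - x ^ d * u := by
      rw [pow_succ]; field_simp
      ring
    rw [this, e']; ring
  rw [e2]; exact h4

lemma main_induction {n : ℕ} {S : Fin n → Set (Set K)} {t : K} (ht : t ≠ 0) {f : Polynomial K}
    (hf : 2 ≤ f.natDegree) (hloc : ∀ i, ∀ v ∈ S i, IsLocality v)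
    (hG : ∀ i, ∀ v ∈ S i, Good t f v)
    (hT : ∀ i, @IsCompact (Set K) (zarStarTop K) (S i))
    (hti : ∀ i j, i ≠ j → SetTIndep t (S i) (S j))
    (hinc : ∀ i j, i ≠ j → SetIncomp (S i) (S j))
    (htW : ∀ i j, i ≠ j → ∀ v ∈ S i, ∀ w ∈ S j, ∀ A : ValuationSubring K, v ⊆ A → w ⊆ A →
      t⁻¹ ∈ A) (x : Fin n → K) (s : Finset (Fin n)) :
    ∀ z : Fin n → K, (∀ i, z i ≠ 0) →
    (∀ i j, i ≠ j → ∀ v ∈ S i, ∀ w ∈ S j, ∀ A : ValuationSubring K, v ⊆ A → w ⊆ A →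
      (z i)⁻¹ * (x i - x j) ∈ A ∧ (z i)⁻¹ * z j ∈ A) →
    ∃ a : K, ∀ i ∈ s, ∀ v ∈ S i, a - x i ∈ scale (z i) (mball v) := by
  induction s using Finset.induction_on with
  | empty => exact fun _ _ _ => ⟨0, by simp⟩
  | insert k s hk ih =>
    intro z hz hI
    rcases (S k).eq_empty_or_nonempty with hSk | ⟨w₀, hw₀⟩
    · obtain ⟨a, ha⟩ := ih z hz hI
      refine ⟨a, fun i hi v hv => ?_⟩
      rcases Finset.mem_insert.1 hi with rfl | hi
      · rw [hSk] at hv; exact hv.elim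
      · exact ha i hi v hv
    by_cases hne : ∃ i ∈ s, (S i).Nonempty
    swap
    · refine ⟨x k, fun i hi v hv => ?_⟩
      rcases Finset.mem_insert.1 hi with rfl | hi
      · exact ⟨0, (hG i v hv).loc.zero_mball, by simp⟩
      · exact absurd ⟨i, hi, v, hv⟩ hne
    obtain ⟨y, hy⟩ := ih (fun i => z i * t) (fun i => mul_ne_zero (hz i) ht) (by
      intro i j hij v hv w hw A h1 h2
      obtain ⟨h3, h4⟩ := hI i j hij v hv w hw A h1 h2
      have h5 := htW i j hij v hv w hw A h1 h2
      constructor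
      · have e : (z i * t)⁻¹ * (x i - x j) = t⁻¹ * ((z i)⁻¹ * (x i - x j)) := by
          rw [mul_inv]; ring
        rw [e]; exact A.mul_mem _ _ h5 h3
      · have e : (z i * t)⁻¹ * (z j * t) = (z i)⁻¹ * z j := by
          have := hz i; field_simp
        rw [e]; exact h4)
    by_cases hc : x k - y = 0
    · refine ⟨y, fun i hi v hv => ?_⟩
      have hg := hG i v hv
      rcases Finset.mem_insert.1 hi with rfl | hi
      · refine ⟨0, hg.loc.zero_mball, ?_⟩
        rw [mul_zero, ← neg_sub, hc, neg_zero]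
      · exact scale_le hg.loc (hy i hi v hv) (hg.t_mem ht)
    set c := x k - y with hcdef
    have hki : ∀ i ∈ s, i ≠ k := fun i hi h => hk (h ▸ hi)
    obtain ⟨a, ha, ha'⟩ := separate ht hf hloc hG hT hti hinc s k hk hne
      (fun i => t ^ 3 * z i / c) (fun i => div_ne_zero (mul_ne_zero (pow_ne_zero _ ht) (hz i)) hc)
      (by
        rintro i hi v hv w hw _ ⟨A, rfl⟩ h1 h2
        have hik := hki i hi
        obtain ⟨h3, h4⟩ := hI i k hik v hv w hw A h1 h2
        obtain ⟨h5, h6⟩ := hI k i hik.symm w hw v hv A h2 h1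
        have h7 := htW i k hik v hv w hw A h1 h2
        have h8 : (z i)⁻¹ * (y - x i) ∈ A := by
          obtain ⟨m, hm, e⟩ := hy i hi v hv
          have hg := hG i v hv
          have e' : (z i)⁻¹ * (y - x i) = t * m := by
            rw [e, mul_assoc, inv_mul_cancel_left₀ (hz i)]
          rw [e']
          exact h1 (hg.loc.mul _ (hg.t_mem ht) _ (mball_sub hm))
        have h9 : (z i)⁻¹ * c ∈ A := by
          have e : (z i)⁻¹ * c = -((z i)⁻¹ * (x i - x k)) - (z i)⁻¹ * (y - x i) := by
            rw [hcdef]; ring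
          rw [e]
          exact sub_mem (neg_mem h3) h8
        have h10 : (z k)⁻¹ * c ∈ A := by
          have e : (z k)⁻¹ * c = ((z k)⁻¹ * z i) * ((z i)⁻¹ * c) := by
            rw [mul_assoc, mul_inv_cancel_left₀ (hz i)]
          rw [e]; exact mul_mem h6 h9
        have e : ∀ j, (t ^ 3 * z j / c)⁻¹ = t⁻¹ ^ 3 * ((z j)⁻¹ * c) := by
          intro j
          rw [inv_div, div_eq_mul_inv, mul_inv, inv_pow]; ring
        constructor
        · rw [e]; exact mul_mem (pow_mem h7 3) h9
        · rw [e]; exact mul_mem (pow_mem h7 3) h10)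
    obtain ⟨d, hd⟩ : ∃ d, f.natDegree = d + 1 := ⟨f.natDegree - 1, by omega⟩
    refine ⟨y + f.leadingCoeff * a ^ (d + 1) * (f.eval a)⁻¹ * c, fun i hi v hv => ?_⟩
    have hg := hG i v hv
    have htv := hg.t_mem ht
    obtain ⟨g, hgO, hg0, hg', hfa⟩ := hg.f_spec ht a
    rcases Finset.mem_insert.1 hi with rfl | hi
    · obtain ⟨ha0, hm, μ, hμ, e⟩ := ha' v hv
      have haO : a ∉ v := by
        have := (mem_mball.1 hm).2 (inv_ne_zero ha0)
        rwa [inv_inv] at this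
      have hfa' : f.eval a = a ^ (d + 1) * g := by
        rcases hfa with h | h
        · exact absurd h.1 haO
        · rw [h.2, hd]
      obtain ⟨-, u, hu, e'⟩ := hg.h3 a haO
      rw [hd, Nat.add_sub_cancel] at e'
      have hlead : f.leadingCoeff * a ^ (d + 1) = f.eval a - a ^ d * u := by rw [e']; ring
      refine ⟨μ * (-u * (t * g⁻¹) * t ^ 2), hg.loc.mball_mul hμ (hg.loc.mul _
        (hg.loc.mul _ (hg.loc.neg _ hu) _ hg') _ (hg.loc.pow htv 2)), ?_⟩
      have hfa0 : f.eval a ≠ 0 := by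
        rw [hfa']; exact mul_ne_zero (pow_ne_zero _ ha0) hg0
      have e3 : a ^ d * (f.eval a)⁻¹ = a⁻¹ * g⁻¹ := by
        rw [hfa', pow_succ]; field_simp
      calc y + f.leadingCoeff * a ^ (d + 1) * (f.eval a)⁻¹ * c - x i
          = y + (f.eval a * (f.eval a)⁻¹) * c - x i - u * c * (a ^ d * (f.eval a)⁻¹) := by
            rw [hlead]; ring
        _ = - (u * c * (a⁻¹ * g⁻¹)) := by
            rw [mul_inv_cancel₀ hfa0, e3, hcdef]; ring
        _ = _ := by
            rw [e]; field_simp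
    · have hik := hki i hi
      obtain ⟨hm, μ, hμ, e⟩ := ha i hi v hv
      have hfa' : f.eval a = g := by
        rcases hfa with h | h
        · exact h.2
        · exact absurd (mball_sub hm) h.1
      obtain ⟨p, -, hp⟩ := Set.not_subset.1 (hinc i k hik v hv w₀ hw₀).2
      have hl := hg.lead_mem ht hf hp
      obtain ⟨μ', hμ', e'⟩ := hy i hi v hv
      have hμ2 : μ * (t * f.leadingCoeff * (t * g⁻¹) * a ^ d) ∈ mball v :=
        hg.loc.mball_mul hμ (hg.loc.mul _ (hg.loc.mul _ hl _ hg') _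
          (hg.loc.pow (mball_sub hm) d))
      refine ⟨_, hg.loc.mball_add ht hg.h4 hμ' hμ2, ?_⟩
      have e3 : a * c = t ^ 3 * z i * μ := by
        rw [e]; field_simp
      calc y + f.leadingCoeff * a ^ (d + 1) * (f.eval a)⁻¹ * c - x i
          = (y - x i) + f.leadingCoeff * a ^ d * g⁻¹ * (a * c) := by rw [hfa']; ring
        _ = _ := by rw [e', e3]; ring

/-- **Theorem 4.5, Situation `m`** (main theorem, strict version). -/
theorem main_theorem_strict {K : Type*} [Field K] (n : ℕ) (S : Fin n → Set (Set K))
    (hloc : ∀ i, ∀ v ∈ S i, IsLocality v)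
    (t : K) (ht : t ≠ 0) (x z : Fin n → K) (hz : ∀ i, z i ≠ 0)
    (hU : AssumptionU (⋃ i, S i) t)
    (hT : ∀ i, @IsCompact (Set K) (zarStarTop K) (S i))
    (hI : ∀ i j, ∀ W : Set K, IsValuationLocality W →
      (∃ v ∈ S i, v ⊆ W) → (∃ v ∈ S j, v ⊆ W) →
      x i - x j ∈ scale (z i) W ∧ scale (z i) W = scale (z j) W)
    (hti : ∀ i j, i ≠ j → SetTIndep t (S i) (S j))
    (hinc : ∀ i j, i ≠ j → SetIncomp (S i) (S j)) :
    ∃ a : K, ∀ i, ∀ v ∈ S i, a - x i ∈ scale (z i) (mball v) := by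
  obtain ⟨f, hf, hfS⟩ := hU
  have hG : ∀ i, ∀ v ∈ S i, Good t f v := by
    intro i v hv
    obtain ⟨h1, h2, h3, h4⟩ := hfS v (Set.mem_iUnion.2 ⟨i, hv⟩)
    exact ⟨(hloc i v hv).locP, h1, h2, h3, h4⟩
  have htW : ∀ i j, i ≠ j → ∀ v ∈ S i, ∀ w ∈ S j, ∀ A : ValuationSubring K, v ⊆ A → w ⊆ A →
      t⁻¹ ∈ A := by
    intro i j hij v hv w hw A h1 h2
    have hfcc := prodBall_fcc (hloc i v hv) (hloc j w hw) (hinc i j hij v hv w hw)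
      (hti i j hij v hv w hw)
    have := ((hti i j hij v hv w hw).1 _ hfcc).2
    exact hfcc.2.2.2 A (Or.inl ⟨A, rfl⟩) h1 h2 this
  obtain ⟨a, ha⟩ := main_induction ht hf hloc hG hT hti hinc htW x Finset.univ z hz (by
    intro i j hij v hv w hw A h1 h2
    obtain ⟨h3, h4⟩ := hI i j A ⟨A, rfl⟩ ⟨v, hv, h1⟩ ⟨w, hw, h2⟩
    rw [mem_scale (hz i)] at h3
    refine ⟨h3, ?_⟩
    have h5 : z j ∈ scale (z j) (A : Set K) := ⟨1, A.one_mem, by simp⟩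
    rw [← h4, mem_scale (hz i)] at h5
    exact h5)
  exact ⟨a, fun i v hv => ha i (Finset.mem_univ i) v hv⟩

end PaperApprox
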